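/- Let S be a Frobenius Poisson algebra over a field k with nondegenerate associative symmetric bilinear form ⟨-,-⟩, let m, n ≥ 1, P ∈ 𝔛^m(S), Q ∈ 𝔛^n(S). Define (P∧₂Q)(a_1,…,a_{m+n}) := Σ_{θ ∈ S_{m,n}, θ(m+n)=m+n} ε(θ) P(a_{θ(1)},…,a_{θ(m)}) Q(a_{θ(m+1)},…,a_{θ(m+n)}). Suppose DQ : S^{n−1} → S satisfies ⟨DQ(a_1,…,a_{n−1}), a_n⟩ = (−1)^{n−1} ⟨Q(a_1,…,a_n), 1⟩ for all a_i ∈ S, and D₂ : S^{m+n−1} → S satisfies ⟨D₂(a_1,…,a_{m+n−1}), a_{m+n}⟩ = (−1)^{m+n−1} ⟨(P∧₂Q)(a_1,…,a_{m+n}), 1⟩ for all a_i ∈ S. Then Q∘P − (−1)^{m−1} D₂ − P∧DQ = 0 as maps S^{m+n−1} → S. -/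

import Mathlib

section PolyDer

variable (k : Type*) [Field k] (S : Type*) [CommRing S] [Algebra k S]

/-- `P : S^m → S` is `k`-multilinear. -/
def IsMultilin (m : ℕ) (P : (Fin m → S) → S) : Prop :=
  (∀ (a : Fin m → S) (i : Fin m) (x y : S),
      P (Function.update a i (x + y)) = P (Function.update a i x) + P (Function.update a i y)) ∧
  (∀ (a : Fin m → S) (i : Fin m) (c : k) (x : S),
      P (Function.update a i (c • x)) = c • P (Function.update a i x))

/-- `P : S^m → S` is skew-symmetric:
`P(a_1, …, a_m) = ε(θ) P(a_{θ(1)}, …, a_{θ(m)})` for every permutation `θ`. -/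
def IsSkewSym (m : ℕ) (P : (Fin m → S) → S) : Prop :=
  ∀ (θ : Equiv.Perm (Fin m)) (a : Fin m → S),
    P a = (Equiv.Perm.sign θ : ℤ) • P (fun i => a (θ i))

/-- `P : S^m → S` is a derivation in each argument. -/
def IsMultiDer (m : ℕ) (P : (Fin m → S) → S) : Prop :=
  ∀ (a : Fin m → S) (i : Fin m) (x y : S),
    P (Function.update a i (x * y)) =
      x * P (Function.update a i y) + y * P (Function.update a i x)

/-- membership in `𝔛^m(S)`: `k`-multilinear, skew-symmetric, and a derivation
in each argument (`𝔛^0(S) = S` since `(Fin 0 → S) → S ≅ S`). -/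
def IsPolyDer (m : ℕ) (P : (Fin m → S) → S) : Prop :=
  IsMultilin k S m P ∧ IsSkewSym S m P ∧ IsMultiDer S m P

end PolyDer

section Shuffles

variable (k : Type*) [Field k] (S : Type*) [CommRing S] [Algebra k S]

/-- `θ` is a `(p, r−p)`-shuffle: `θ` is increasing on `{0, …, p−1}` and on
`{p, …, r−1}` (0-based indexing). -/
def IsShuffle {r : ℕ} (p : ℕ) (θ : Equiv.Perm (Fin r)) : Prop :=
  ∀ i j : Fin r, i < j → ((j : ℕ) < p ∨ p ≤ (i : ℕ)) → θ i < θ j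

instance {r : ℕ} (p : ℕ) (θ : Equiv.Perm (Fin r)) : Decidable (IsShuffle p θ) := by
  unfold IsShuffle; infer_instance

/-- The wedge product
`(P∧Q)(a_1,…,a_r) = Σ_{θ ∈ S_{m,n}} ε(θ) P(a_{θ(1)},…,a_{θ(m)}) Q(a_{θ(m+1)},…,a_{θ(m+n)})`
of multilinear maps `P : S^m → S` and `Q : S^n → S`, with `r = m + n`. -/
noncomputable def wedgeProd (m n r : ℕ) (h : m + n = r)
    (P : (Fin m → S) → S) (Q : (Fin n → S) → S) : (Fin r → S) → S := fun a =>
  ∑ θ : Equiv.Perm (Fin r),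
    if IsShuffle m θ then
      (Equiv.Perm.sign θ : ℤ) •
        (P (fun i => a (θ ⟨(i : ℕ), by have := i.isLt; omega⟩)) *
         Q (fun j => a (θ ⟨m + (j : ℕ), by have := j.isLt; omega⟩)))
    else 0

/-- The partial wedge product `P ∧₁ Q`: only the shuffles with `θ(m) = m+n`
(`1`-based), i.e. `θ(m−1) = r−1` (0-based), contribute. -/
noncomputable def wedgeFstProd (m n r : ℕ) (h : m + n = r) (hm : 1 ≤ m)
    (P : (Fin m → S) → S) (Q : (Fin n → S) → S) : (Fin r → S) → S := fun a =>
  ∑ θ : Equiv.Perm (Fin r),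
    if IsShuffle m θ ∧ θ ⟨m - 1, by omega⟩ = ⟨r - 1, by omega⟩ then
      (Equiv.Perm.sign θ : ℤ) •
        (P (fun i => a (θ ⟨(i : ℕ), by have := i.isLt; omega⟩)) *
         Q (fun j => a (θ ⟨m + (j : ℕ), by have := j.isLt; omega⟩)))
    else 0

/-- The partial wedge product `P ∧₂ Q`: only the shuffles with
`θ(m+n) = m+n` (`1`-based), i.e. `θ(r−1) = r−1` (0-based), contribute. -/
noncomputable def wedgeSndProd (m n r : ℕ) (h : m + n = r) (hm : 1 ≤ m)
    (P : (Fin m → S) → S) (Q : (Fin n → S) → S) : (Fin r → S) → S := fun a =>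
  ∑ θ : Equiv.Perm (Fin r),
    if IsShuffle m θ ∧ θ ⟨r - 1, by omega⟩ = ⟨r - 1, by omega⟩ then
      (Equiv.Perm.sign θ : ℤ) •
        (P (fun i => a (θ ⟨(i : ℕ), by have := i.isLt; omega⟩)) *
         Q (fun j => a (θ ⟨m + (j : ℕ), by have := j.isLt; omega⟩)))
    else 0

/-- The circle product
`(P∘Q)(a_1,…,a_r) = Σ_{θ ∈ S_{n,m−1}} ε(θ) P(Q(a_{θ(1)},…,a_{θ(n)}), a_{θ(n+1)},…,a_{θ(n+m−1)})`
of multilinear maps `P : S^m → S` and `Q : S^n → S`, with `r = m + n − 1`,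
`m ≥ 1`. -/
noncomputable def circProd (m n r : ℕ) (h : m + n = r + 1) (hm : 1 ≤ m)
    (P : (Fin m → S) → S) (Q : (Fin n → S) → S) : (Fin r → S) → S := fun a =>
  ∑ θ : Equiv.Perm (Fin r),
    if IsShuffle n θ then
      (Equiv.Perm.sign θ : ℤ) • P (fun l =>
        if h0 : (l : ℕ) = 0 then
          Q (fun i => a (θ ⟨(i : ℕ), by have := i.isLt; omega⟩))
        else a (θ ⟨n + ((l : ℕ) - 1), by have := l.isLt; omega⟩))
    else 0

end Shuffles

section FixedLast

/-- The extension of a permutation of `Fin r` to `Fin (r + 1)` fixing the last element. -/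
noncomputable def permExtendLast {r : ℕ} (τ : Equiv.Perm (Fin r)) : Equiv.Perm (Fin (r + 1)) :=
  τ.viaFintypeEmbedding Fin.castSuccEmb

lemma permExtendLast_castSucc {r : ℕ} (τ : Equiv.Perm (Fin r)) (i : Fin r) :
    permExtendLast τ i.castSucc = (τ i).castSucc :=
  τ.viaFintypeEmbedding_apply_image Fin.castSuccEmb i

lemma permExtendLast_last {r : ℕ} (τ : Equiv.Perm (Fin r)) :
    permExtendLast τ (Fin.last r) = Fin.last r := by
  refine τ.viaFintypeEmbedding_apply_notMem_range Fin.castSuccEmb ?_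
  rintro ⟨i, hi⟩
  exact (Fin.castSucc_lt_last i).ne hi

lemma sign_permExtendLast {r : ℕ} (τ : Equiv.Perm (Fin r)) :
    Equiv.Perm.sign (permExtendLast τ) = Equiv.Perm.sign τ :=
  τ.viaFintypeEmbedding_sign _

lemma permExtendLast_injective {r : ℕ} :
    Function.Injective (permExtendLast : Equiv.Perm (Fin r) → Equiv.Perm (Fin (r + 1))) := by
  intro τ τ' h
  ext i
  have := congrArg (fun σ => σ i.castSucc) h
  simp only [permExtendLast_castSucc] at this
  rw [Fin.castSucc_injective r this]

lemma exists_permExtendLast_eq {r : ℕ} (σ : Equiv.Perm (Fin (r + 1)))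
    (h : σ (Fin.last r) = Fin.last r) : ∃ τ, permExtendLast τ = σ := by
  have hne (i : Fin r) : σ i.castSucc ≠ Fin.last r := fun hi =>
    (Fin.castSucc_lt_last i).ne (σ.injective (hi.trans h.symm))
  have hinj : Function.Injective fun i : Fin r => (σ i.castSucc).castPred (hne i) := fun i j hij =>
    Fin.castSucc_injective r (σ.injective (Fin.castPred_inj.mp hij))
  refine ⟨Equiv.ofBijective _ (Finite.injective_iff_bijective.mp hinj), Equiv.ext fun i => ?_⟩
  induction i using Fin.lastCases with
  | last => rw [permExtendLast_last, h]
  | cast i => rw [permExtendLast_castSucc, Equiv.ofBijective_apply, Fin.castSucc_castPred]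

lemma isShuffle_permExtendLast {r m : ℕ} (τ : Equiv.Perm (Fin r)) :
    IsShuffle m (permExtendLast τ) ↔ IsShuffle m τ := by
  constructor
  · intro h i j hij hc
    simpa [permExtendLast_castSucc] using h i.castSucc j.castSucc (by simpa using hij) hc
  · intro h i j hij hc
    induction i using Fin.lastCases with
    | last => exact absurd hij (Fin.le_last j).not_gt
    | cast i =>
      induction j using Fin.lastCases with
      | last =>
        rw [permExtendLast_castSucc, permExtendLast_last]
        exact Fin.castSucc_lt_last _
      | cast j =>
        rw [permExtendLast_castSucc, permExtendLast_castSucc]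
        exact Fin.castSucc_lt_castSucc_iff.mpr (h i j (by simpa using hij) hc)

end FixedLast

section PolyDerivations

variable {S : Type*} [CommRing S]

lemma IsMultiDer.snoc_mul {q : ℕ} {Q : (Fin (q + 1) → S) → S} (hQ : IsMultiDer S (q + 1) Q)
    (b : Fin q → S) (x y : S) :
    Q (Fin.snoc b (x * y) : Fin (q + 1) → S) =
      x * Q (Fin.snoc b y : Fin (q + 1) → S) + y * Q (Fin.snoc b x : Fin (q + 1) → S) := by
  simpa [Fin.update_snoc_last] using hQ (Fin.snoc b 0 : Fin (q + 1) → S) (Fin.last q) x y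

lemma IsSkewSym.cons_eq_snoc {q : ℕ} {Q : (Fin (q + 1) → S) → S} (hQ : IsSkewSym S (q + 1) Q)
    (b : Fin q → S) (y : S) :
    Q (Fin.cons y b : Fin (q + 1) → S) = (-1 : ℤ) ^ q • Q (Fin.snoc b y : Fin (q + 1) → S) := by
  rw [hQ (finRotate (q + 1)), sign_finRotate, Fin.snoc_eq_cons_rotate]
  simp

/-- `P ∧₂ Q` as a sum over the shuffles of all arguments but the last one. -/
lemma wedgeSndProd_snoc (p q : ℕ) (h : p + 1 + (q + 1) = p + q + 2) (hp : 1 ≤ p + 1)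
    (P : (Fin (p + 1) → S) → S) (Q : (Fin (q + 1) → S) → S)
    (a : Fin (p + q + 1) → S) (x : S) :
    wedgeSndProd S (p + 1) (q + 1) (p + q + 2) h hp P Q (Fin.snoc a x) =
      ∑ τ : Equiv.Perm (Fin (p + q + 1)),
        if IsShuffle (p + 1) τ then
          (Equiv.Perm.sign τ : ℤ) •
            (P (fun i => a (τ ⟨(i : ℕ), by have := i.isLt; omega⟩)) *
              Q (Fin.snoc (fun j : Fin q => a (τ ⟨p + 1 + (j : ℕ), by have := j.isLt; omega⟩)) x))
        else 0 := by
  symm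
  refine Fintype.sum_of_injective permExtendLast permExtendLast_injective _ _ ?_ ?_
  · intro σ hσ
    refine if_neg fun h => hσ (exists_permExtendLast_eq σ h.2)
  · intro τ
    have hlast : permExtendLast τ ⟨p + q + 2 - 1, by omega⟩ = ⟨p + q + 2 - 1, by omega⟩ :=
      permExtendLast_last τ
    have hP : (fun i : Fin (p + 1) => (Fin.snoc a x : Fin (p + q + 2) → S)
        (permExtendLast τ ⟨(i : ℕ), by have := i.isLt; omega⟩)) =
        fun i : Fin (p + 1) => a (τ ⟨(i : ℕ), by have := i.isLt; omega⟩) := by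
      funext i
      have := permExtendLast_castSucc τ ⟨(i : ℕ), by have := i.isLt; omega⟩
      rw [Fin.castSucc_mk] at this
      rw [this]
      exact Fin.snoc_castSucc (α := fun _ => S) _ _ _
    have hQ : (fun j : Fin (q + 1) => (Fin.snoc a x : Fin (p + q + 2) → S)
        (permExtendLast τ ⟨p + 1 + (j : ℕ), by have := j.isLt; omega⟩)) =
        Fin.snoc (fun j : Fin q => a (τ ⟨p + 1 + (j : ℕ), by have := j.isLt; omega⟩)) x := by
      funext j
      induction j using Fin.lastCases with
      | last =>
        have h : (⟨p + 1 + (Fin.last q : ℕ), by simp; omega⟩ : Fin (p + q + 1 + 1)) =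
            Fin.last (p + q + 1) := Fin.ext (by simp; omega)
        rw [h, permExtendLast_last, Fin.snoc_last]
        exact (Fin.snoc_last (α := fun _ => S) _ _).symm
      | cast j =>
        have := permExtendLast_castSucc τ ⟨p + 1 + (j : ℕ), by have := j.isLt; omega⟩
        rw [Fin.castSucc_mk] at this
        simp only [Fin.val_castSucc, Fin.snoc_castSucc]
        rw [this]
        exact Fin.snoc_castSucc (α := fun _ => S) _ _ _
    rw [hP, hQ, sign_permExtendLast]
    simp only [hlast, and_true, isShuffle_permExtendLast]

/-- `Q ∘ P` with the inserted value written as the head of the argument tuple. -/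
lemma circProd_eq_sum_cons (p q : ℕ) (h : q + 1 + (p + 1) = p + q + 1 + 1) (hq : 1 ≤ q + 1)
    (P : (Fin (p + 1) → S) → S) (Q : (Fin (q + 1) → S) → S)
    (a : Fin (p + q + 1) → S) :
    circProd S (q + 1) (p + 1) (p + q + 1) h hq Q P a =
      ∑ τ : Equiv.Perm (Fin (p + q + 1)),
        if IsShuffle (p + 1) τ then
          (Equiv.Perm.sign τ : ℤ) •
            Q (Fin.cons (P fun i => a (τ ⟨(i : ℕ), by have := i.isLt; omega⟩))
              fun j : Fin q => a (τ ⟨p + 1 + (j : ℕ), by have := j.isLt; omega⟩))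
        else 0 := by
  refine Finset.sum_congr rfl fun τ _ => ?_
  congr 3
  funext l
  induction l using Fin.cases with
  | zero => simp
  | succ l => simp

end PolyDerivations

/-- the `∧₂`-identity
`Q∘P − (−1)^{m−1} Δ(P∧₂Q) − P∧Δ(Q) = 0`, with `m = p+1`, `n = q+1`. -/
theorem bv_wedge_two_identity
    (k : Type*) [Field k] (S : Type*) [CommRing S] [Algebra k S]
    [FiniteDimensional k S]
    -- the Poisson bracket on S, k-bilinear
    (br : S →ₗ[k] S →ₗ[k] S)
    (hanti : ∀ a b : S, br a b = - br b a)
    (hjacobi : ∀ a b c : S, br a (br b c) + br b (br c a) + br c (br a b) = 0)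
    (hleib : ∀ a b c : S, br a (b * c) = br a b * c + br a c * b)
    -- the Frobenius bilinear form ⟨-,-⟩, nondegenerate, associative, symmetric
    (B : S →ₗ[k] S →ₗ[k] k)
    (hBnd : ∀ a : S, (∀ b : S, B a b = 0) → a = 0)
    (hBassoc : ∀ a b c : S, B (a * b) c = B a (b * c))
    (hBsymm : ∀ a b : S, B a b = B b a)
    -- P ∈ 𝔛^{p+1}(S), Q ∈ 𝔛^{q+1}(S)
    (p q : ℕ)
    (P : (Fin (p+1) → S) → S) (hP : IsPolyDer k S (p+1) P)
    (Q : (Fin (q+1) → S) → S) (hQ : IsPolyDer k S (q+1) Q)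
    -- DQ = Δ(Q)
    (DQ : (Fin q → S) → S)
    (hDQ : ∀ (a : Fin q → S) (x : S),
      B (DQ a) x = (-1 : ℤ)^q • B (Q (Fin.snoc a x)) 1)
    -- D₂ = Δ(P ∧₂ Q)
    (D₂ : (Fin (p+q+1) → S) → S)
    (hD₂ : ∀ (a : Fin (p+q+1) → S) (x : S),
      B (D₂ a) x = (-1 : ℤ)^(p+q+1) •
        B (wedgeSndProd S (p+1) (q+1) (p+q+2) (by omega) (by omega) P Q (Fin.snoc a x)) 1) :
    ∀ a : Fin (p+q+1) → S,
      circProd S (q+1) (p+1) (p+q+1) (by omega) (by omega) Q P a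
        - (-1 : ℤ)^p • D₂ a
        - wedgeProd S (p+1) q (p+q+1) (by omega) P DQ a = 0 := by
  intro a
  refine hBnd _ fun x => ?_
  rw [map_sub, map_sub, map_zsmul, LinearMap.sub_apply, LinearMap.sub_apply, LinearMap.smul_apply,
    hD₂, wedgeSndProd_snoc, circProd_eq_sum_cons, wedgeProd]
  simp only [map_sum, LinearMap.sum_apply, Finset.smul_sum]
  rw [← Finset.sum_sub_distrib, ← Finset.sum_sub_distrib]
  refine Finset.sum_eq_zero fun τ _ => ?_
  split_ifs
  · set u := P fun i => a (τ ⟨(i : ℕ), by have := i.isLt; omega⟩)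
    set b : Fin q → S := fun j => a (τ ⟨p + 1 + (j : ℕ), by have := j.isLt; omega⟩)
    have hW : B (u * DQ b) x = (-1 : ℤ) ^ q • (B (u * Q (Fin.snoc b x)) 1 +
        B (Q (Fin.snoc b u)) x) := by
      rw [mul_comm u, hBassoc, hDQ, hQ.2.2.snoc_mul, map_add, LinearMap.add_apply,
        mul_comm x, hBassoc _ x, mul_one]
    simp only [map_zsmul, LinearMap.smul_apply, hW, hQ.2.1.cons_eq_snoc]
    simp only [zsmul_eq_mul]
    push_cast
    have hp : ((-1 : k) ^ p) * (-1) ^ p = 1 := by rw [← mul_pow]; simp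
    linear_combination (-1 : k) ^ q * (Equiv.Perm.sign τ : ℤ) * B (u * Q (Fin.snoc b x)) 1 * hp
  · simp
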